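/- For every x ∈ X with x_k > 0 for all k ∈ K, the derivative of L^{(a)} along the GRAND(aZ) fluid vector field equals Ξ(x); that is, Σ_{k∈K} log(x_k c_k/a_s)·F_k(x) = Ξ(x), where for k ∈ K^s the factor is log(x_k c_k/a_s). -/

import Mathlib

open scoped BigOperators
open Filter Topology

noncomputable section

variable {I S : Type} [Fintype I] [DecidableEq I] [Fintype S]

/-- The configuration `e_i` consisting of a single type-`i` customer. -/
def econf (i : I) : I → ℕ := Pi.single i 1

/-- `K^s`: the set of nonzero configurations of server type `s`. -/
def Kc (Kbar : S → Finset (I → ℕ)) (s : S) : Finset (I → ℕ) := (Kbar s).erase 0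

/-- Monotonicity of the configuration sets. -/
def KbarMono (Kbar : S → Finset (I → ℕ)) : Prop :=
  ∀ s, ∀ k ∈ Kbar s, ∀ k' : I → ℕ, (∀ i, k' i ≤ k i) → k' ∈ Kbar s

/-- Each configuration set contains the zero configuration. -/
def KbarZero (Kbar : S → Finset (I → ℕ)) : Prop := ∀ s, (0 : I → ℕ) ∈ Kbar s

/-- Every customer type can be served by some server type. -/
def KbarServe (Kbar : S → Finset (I → ℕ)) : Prop := ∀ i : I, ∃ s, econf i ∈ Kbar s

/-- `ℝ_+^K`: nonnegative vectors supported on the nonzero configurations. -/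
def orthK (Kbar : S → Finset (I → ℕ)) : Set (S → (I → ℕ) → ℝ) :=
  {x | (∀ s k, 0 ≤ x s k) ∧ ∀ s, ∀ k, k ∉ Kc Kbar s → x s k = 0}

/-- The feasible set `X` (equality constraints). -/
def feasX (Kbar : S → Finset (I → ℕ)) (ρ : I → ℝ) : Set (S → (I → ℕ) → ℝ) :=
  {x | x ∈ orthK Kbar ∧ ∀ i, ∑ s, ∑ k ∈ Kc Kbar s, (k i : ℝ) * x s k = ρ i}

/-- The relaxed feasible set (inequality constraints). -/
def feasXge (Kbar : S → Finset (I → ℕ)) (ρ : I → ℝ) : Set (S → (I → ℕ) → ℝ) :=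
  {x | x ∈ orthK Kbar ∧ ∀ i, ρ i ≤ ∑ s, ∑ k ∈ Kc Kbar s, (k i : ℝ) * x s k}

/-- The weighted number of occupied servers. -/
def objW (Kbar : S → Finset (I → ℕ)) (γ : S → ℝ) (x : S → (I → ℕ) → ℝ) : ℝ :=
  ∑ s, ∑ k ∈ Kc Kbar s, γ s * x s k

/-- `X*`: optimal solutions of LP=. -/
def XstarSet (Kbar : S → Finset (I → ℕ)) (ρ : I → ℝ) (γ : S → ℝ) :
    Set (S → (I → ℕ) → ℝ) :=
  {x | x ∈ feasX Kbar ρ ∧ ∀ y ∈ feasX Kbar ρ, objW Kbar γ x ≤ objW Kbar γ y}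

/-- `X**`: optimal solutions of LP≤. -/
def XstarSetGe (Kbar : S → Finset (I → ℕ)) (ρ : I → ℝ) (γ : S → ℝ) :
    Set (S → (I → ℕ) → ℝ) :=
  {x | x ∈ feasXge Kbar ρ ∧ ∀ y ∈ feasXge Kbar ρ, objW Kbar γ x ≤ objW Kbar γ y}

/-- `H*`: dual optimal vectors. -/
def HstarSet (Kbar : S → Finset (I → ℕ)) (ρ : I → ℝ) (γ : S → ℝ) : Set (I → ℝ) :=
  {η | ∃ x ∈ feasX Kbar ρ, (∀ i, 0 ≤ η i) ∧
    (∀ s, ∀ k ∈ Kc Kbar s, ∑ i, (k i : ℝ) * η i ≤ γ s) ∧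
    (∀ s, ∀ k ∈ Kc Kbar s, (∑ i, (k i : ℝ) * η i) < γ s → x s k = 0)}

/-- `c_k = ∏_i k_i!`. -/
def ck (k : I → ℕ) : ℝ := ∏ i, (Nat.factorial (k i) : ℝ)

/-- The function `L^{(a)}`. -/
def Lfun (Kbar : S → Finset (I → ℕ)) (a : S → ℝ) (x : S → (I → ℕ) → ℝ) : ℝ :=
  ∑ s, ∑ k ∈ Kc Kbar s, x s k * Real.log (x s k * ck k / (Real.exp 1 * a s))

/-- Product form (infinite-server system). -/
def prodForm (Kbar : S → Finset (I → ℕ)) (a : S → ℝ) (x : S → (I → ℕ) → ℝ)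
    (ν : I → ℝ) : Prop :=
  ∀ s, ∀ k ∈ Kc Kbar s, x s k = a s / ck k * Real.exp (∑ i, (k i : ℝ) * ν i)

/-- ℓ¹ distance on the coordinates indexed by `K`. -/
def distK (Kbar : S → Finset (I → ℕ)) (x y : S → (I → ℕ) → ℝ) : ℝ :=
  ∑ s, ∑ k ∈ Kc Kbar s, |x s k - y s k|

/-- Extended coordinate value: the zero configuration of type `s` has value `a_s`. -/
def xval (a : S → ℝ) (x : S → (I → ℕ) → ℝ) (s : S) (k : I → ℕ) : ℝ :=
  if k = 0 then a s else x s k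

/-- `x_{(i)}`: amount of servers available to a type-`i` arrival (GRAND(aZ)). -/
def xavail (Kbar : S → Finset (I → ℕ)) (a : S → ℝ) (x : S → (I → ℕ) → ℝ) (i : I) : ℝ :=
  ∑ s, ((if econf i ∈ Kc Kbar s then a s else 0)
    + ∑ k ∈ (Kc Kbar s).filter (fun k => k + econf i ∈ Kbar s), x s k)

/-- Departure rate `w_{k i}`. -/
def wrate (μ : I → ℝ) (x : S → (I → ℕ) → ℝ) (s : S) (k : I → ℕ) (i : I) : ℝ :=
  (k i : ℝ) * μ i * x s k

/-- Arrival rate `v_{k i}` (GRAND(aZ)), with `λ_i = μ_i ρ_i`. -/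
def vrate (Kbar : S → Finset (I → ℕ)) (a : S → ℝ) (μ ρ : I → ℝ)
    (x : S → (I → ℕ) → ℝ) (s : S) (k : I → ℕ) (i : I) : ℝ :=
  μ i * ρ i * xval a x s (k - econf i) / xavail Kbar a x i

/-- The GRAND(aZ) fluid vector field `F_k(x)`, for `k ∈ K^s`. -/
def Fdrift (Kbar : S → Finset (I → ℕ)) (a : S → ℝ) (μ ρ : I → ℝ)
    (x : S → (I → ℕ) → ℝ) (s : S) (k : I → ℕ) : ℝ :=
  (∑ i ∈ Finset.univ.filter (fun i : I => 1 ≤ k i ∧ k - econf i ∈ Kbar s),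
    (vrate Kbar a μ ρ x s k i - wrate μ x s k i))
  - ∑ i ∈ Finset.univ.filter (fun i : I => k + econf i ∈ Kbar s),
    (vrate Kbar a μ ρ x s (k + econf i) i - wrate μ x s (k + econf i) i)

/-- The function `Ξ(x)` (GRAND(aZ)). -/
def Xi (Kbar : S → Finset (I → ℕ)) (a : S → ℝ) (μ : I → ℝ)
    (x : S → (I → ℕ) → ℝ) : ℝ :=
  ∑ i : I, ∑ s : S,
    ∑ k ∈ (Kc Kbar s).filter (fun k => 1 ≤ k i ∧ k - econf i ∈ Kbar s),
      ∑ s' : S,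
        ∑ k' ∈ (Kc Kbar s').filter (fun k' => 1 ≤ k' i ∧ k' - econf i ∈ Kbar s'),
          (Real.log ((k' i : ℝ) * xval a x s (k - econf i) * x s' k')
            - Real.log ((k i : ℝ) * x s k * xval a x s' (k' - econf i)))
          * ((k i : ℝ) * μ i * x s k * xval a x s' (k' - econf i) / xavail Kbar a x i)

open Classical in
/-- `Ξ` extended by `−∞` to points with a vanishing coordinate, as a map into `[−∞, 0] ⊆ EReal`. -/
def XiE (Kbar : S → Finset (I → ℕ)) (a : S → ℝ) (μ : I → ℝ)
    (x : S → (I → ℕ) → ℝ) : EReal :=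
  if ∀ s, ∀ k ∈ Kc Kbar s, 0 < x s k then ((Xi Kbar a μ x : ℝ) : EReal) else ⊥

/-! Finite-server (GRAND-F) objects. -/

/-- `X^□`. -/
def XBox (Kbar : S → Finset (I → ℕ)) (h : S → ℝ) : Set (S → (I → ℕ) → ℝ) :=
  {x | x ∈ orthK Kbar ∧ ∀ s, ∑ k ∈ Kc Kbar s, x s k ≤ h s}

/-- `x_{0^s} = h_s − Σ_{k∈K^s} x_k`. -/
def x0 (Kbar : S → Finset (I → ℕ)) (h : S → ℝ) (x : S → (I → ℕ) → ℝ) (s : S) : ℝ :=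
  h s - ∑ k ∈ Kc Kbar s, x s k

/-- `X^⋄ = X^□ ∩ X`. -/
def XDiamond (Kbar : S → Finset (I → ℕ)) (h : S → ℝ) (ρ : I → ℝ) :
    Set (S → (I → ℕ) → ℝ) := XBox Kbar h ∩ feasX Kbar ρ

/-- Assumption A: a feasible point with idle servers of every type. -/
def AssumptionA (Kbar : S → Finset (I → ℕ)) (h : S → ℝ) (ρ : I → ℝ) : Prop :=
  ∃ x ∈ XDiamond Kbar h ρ, ∀ s, 0 < x0 Kbar h x s

/-- The function `L^□`. -/
def LBox (Kbar : S → Finset (I → ℕ)) (h : S → ℝ) (x : S → (I → ℕ) → ℝ) : ℝ :=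
  ∑ s, (x0 Kbar h x s * Real.log (x0 Kbar h x s / Real.exp 1)
    + ∑ k ∈ Kc Kbar s, x s k * Real.log (x s k * ck k / Real.exp 1))

/-- Product form (finite-server system), including the zero configurations. -/
def prodFormBox (Kbar : S → Finset (I → ℕ)) (h : S → ℝ) (x : S → (I → ℕ) → ℝ)
    (ν : I → ℝ) (β : S → ℝ) : Prop :=
  ∀ s, x0 Kbar h x s = Real.exp (-β s) ∧
    ∀ k ∈ Kc Kbar s, x s k = Real.exp (-β s) / ck k * Real.exp (∑ i, (k i : ℝ) * ν i)

/-- Extended coordinate value for the finite-server system. -/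
def xvalBox (Kbar : S → Finset (I → ℕ)) (h : S → ℝ) (x : S → (I → ℕ) → ℝ)
    (s : S) (k : I → ℕ) : ℝ :=
  if k = 0 then x0 Kbar h x s else x s k

/-- `x_{(i)}` for the finite-server system (zero configurations included). -/
def xavailBox (Kbar : S → Finset (I → ℕ)) (h : S → ℝ) (x : S → (I → ℕ) → ℝ)
    (i : I) : ℝ :=
  ∑ s, ((if econf i ∈ Kc Kbar s then x0 Kbar h x s else 0)
    + ∑ k ∈ (Kc Kbar s).filter (fun k => k + econf i ∈ Kbar s), x s k)

/-- Arrival rate `v_{k i}` (GRAND-F), with `λ_i = μ_i ρ_i`. -/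
def vrateBox (Kbar : S → Finset (I → ℕ)) (h : S → ℝ) (μ ρ : I → ℝ)
    (x : S → (I → ℕ) → ℝ) (s : S) (k : I → ℕ) (i : I) : ℝ :=
  μ i * ρ i * xvalBox Kbar h x s (k - econf i) / xavailBox Kbar h x i

/-- The GRAND-F fluid vector field `F^□_k(x)`, for `k ∈ K^s`. -/
def FdriftBox (Kbar : S → Finset (I → ℕ)) (h : S → ℝ) (μ ρ : I → ℝ)
    (x : S → (I → ℕ) → ℝ) (s : S) (k : I → ℕ) : ℝ :=
  (∑ i ∈ Finset.univ.filter (fun i : I => 1 ≤ k i ∧ k - econf i ∈ Kbar s),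
    (vrateBox Kbar h μ ρ x s k i - wrate μ x s k i))
  - ∑ i ∈ Finset.univ.filter (fun i : I => k + econf i ∈ Kbar s),
    (vrateBox Kbar h μ ρ x s (k + econf i) i - wrate μ x s (k + econf i) i)

/-- The function `Ξ^□(x̄)`. -/
def XiBox (Kbar : S → Finset (I → ℕ)) (h : S → ℝ) (μ : I → ℝ)
    (x : S → (I → ℕ) → ℝ) : ℝ :=
  ∑ i : I, ∑ s : S,
    ∑ k ∈ (Kc Kbar s).filter (fun k => 1 ≤ k i ∧ k - econf i ∈ Kbar s),
      ∑ s' : S,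
        ∑ k' ∈ (Kc Kbar s').filter (fun k' => 1 ≤ k' i ∧ k' - econf i ∈ Kbar s'),
          (Real.log ((k' i : ℝ) * xvalBox Kbar h x s (k - econf i) * x s' k')
            - Real.log ((k i : ℝ) * x s k * xvalBox Kbar h x s' (k' - econf i)))
          * ((k i : ℝ) * μ i * x s k * xvalBox Kbar h x s' (k' - econf i)
              / xavailBox Kbar h x i)

/-- `M_i^s`: the configurations of server type `s` reachable by a type-`i` arrival. -/
def arrivalConf (Kbar : S → Finset (I → ℕ)) (i : I) (s : S) : Finset (I → ℕ) :=
  (Kc Kbar s).filter (fun k => 1 ≤ k i ∧ k - econf i ∈ Kbar s)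

omit [Fintype I] in
theorem sub_econf_add_econf {k : I → ℕ} {i : I} (h : 1 ≤ k i) :
    k - econf i + econf i = k := by
  refine tsub_add_cancel_of_le fun j => ?_
  by_cases hj : j = i
  · subst hj; simpa [econf] using h
  · simp [econf, hj]

omit [Fintype S] in
/-- Reindexing the arrivals of type `i` by the configuration before the arrival. -/
theorem sum_arrivalConf_eq {Kbar : S → Finset (I → ℕ)} (hzero : KbarZero Kbar)
    (i : I) (s : S) (f : (I → ℕ) → (I → ℕ) → ℝ) :
    ∑ k ∈ arrivalConf Kbar i s, f (k - econf i) k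
      = (if econf i ∈ Kc Kbar s then f 0 (econf i) else 0)
        + ∑ k ∈ (Kc Kbar s).filter (fun k => k + econf i ∈ Kbar s), f k (k + econf i) := by
  have hne : ∀ k : I → ℕ, k + econf i ≠ 0 := fun k h => by
    simpa [econf] using congrFun h i
  have hreindex : ∑ k ∈ arrivalConf Kbar i s, f (k - econf i) k
      = ∑ k ∈ (Kbar s).filter (fun k => k + econf i ∈ Kbar s), f k (k + econf i) := by
    refine Finset.sum_bij' (fun k _ => k - econf i) (fun k _ => k + econf i) ?_ ?_ ?_ ?_ ?_
    · intro k hk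
      simp only [arrivalConf, Kc, Finset.mem_filter, Finset.mem_erase] at hk ⊢
      rw [sub_econf_add_econf hk.2.1]
      exact ⟨hk.2.2, hk.1.2⟩
    · intro k hk
      simp only [arrivalConf, Kc, Finset.mem_filter, Finset.mem_erase] at hk ⊢
      refine ⟨⟨hne k, hk.2⟩, by simp [econf], ?_⟩
      rw [add_tsub_cancel_right]
      exact hk.1
    · intro k hk
      simp only [arrivalConf, Finset.mem_filter] at hk
      exact sub_econf_add_econf hk.2.1
    · intro k _
      exact add_tsub_cancel_right k (econf i)
    · intro k hk
      simp only [arrivalConf, Finset.mem_filter] at hk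
      rw [sub_econf_add_econf hk.2.1]
  have hmem : econf i ∈ Kc Kbar s ↔ econf i ∈ Kbar s := by
    have := hne 0
    rw [zero_add] at this
    simp [Kc, this]
  rw [hreindex, ← Finset.insert_erase (hzero s), Finset.filter_insert]
  simp only [Finset.insert_erase (hzero s), zero_add, hmem]
  split_ifs with h
  · rw [Finset.sum_insert (by simp), zero_add]
    rfl
  · rw [zero_add]
    rfl

omit [DecidableEq I] in
theorem ck_pos (k : I → ℕ) : 0 < ck k :=
  Finset.prod_pos fun _ _ => by positivity

theorem ck_eq_mul_ck_sub_econf {k : I → ℕ} {i : I} (h : 1 ≤ k i) :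
    ck k = k i * ck (k - econf i) := by
  unfold ck
  rw [← Finset.mul_prod_erase _ _ (Finset.mem_univ i),
    ← Finset.mul_prod_erase Finset.univ (fun j => (Nat.factorial ((k - econf i) j) : ℝ))
      (Finset.mem_univ i), ← mul_assoc]
  congr 1
  · rw [← Nat.mul_factorial_pred (by omega : k i ≠ 0)]
    simp [econf]
  · refine Finset.prod_congr rfl fun j hj => ?_
    simp [econf, Finset.ne_of_mem_erase hj]

/-- Antisymmetrization of a weighted sum of net rates between two positive distributions. -/
theorem sum_mul_net_rate_eq {P : Type*} (T : Finset P) (l y b : P → ℝ) (m A r : ℝ)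
    (hA : ∑ p ∈ T, b p = A) (hA0 : A ≠ 0) (hr : ∑ p ∈ T, y p = r) :
    ∑ p ∈ T, l p * (m * r * b p / A - y p * m)
      = ∑ p ∈ T, ∑ q ∈ T, (l q - l p) * (y p * m * b q / A) := by
  have h1 : ∑ p ∈ T, ∑ q ∈ T, l q * (y p * m * b q / A)
      = ∑ p ∈ T, l p * (m * r * b p / A) := by
    rw [Finset.sum_comm]
    refine Finset.sum_congr rfl fun q _ => ?_
    rw [← hr, Finset.mul_sum, Finset.sum_mul, Finset.sum_div, Finset.mul_sum]
    exact Finset.sum_congr rfl fun p _ => by ring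
  have h2 : ∑ p ∈ T, ∑ q ∈ T, l p * (y p * m * b q / A)
      = ∑ p ∈ T, l p * (y p * m) := by
    refine Finset.sum_congr rfl fun p _ => ?_
    rw [← Finset.mul_sum, ← Finset.sum_div, ← Finset.mul_sum, hA, mul_div_cancel_right₀ _ hA0]
  simp only [mul_sub, sub_mul, Finset.sum_sub_distrib, h1, h2]

/-- Summation by parts: a linear functional of the drift as a sum over arrivals. -/
theorem sum_mul_Fdrift_eq {Kbar : S → Finset (I → ℕ)} (hzero : KbarZero Kbar)
    (a : S → ℝ) (μ ρ : I → ℝ) (x : S → (I → ℕ) → ℝ) (s : S) (g : (I → ℕ) → ℝ)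
    (hg : g 0 = 0) :
    ∑ k ∈ Kc Kbar s, g k * Fdrift Kbar a μ ρ x s k
      = ∑ i, ∑ k ∈ arrivalConf Kbar i s,
          (g k - g (k - econf i)) * (vrate Kbar a μ ρ x s k i - wrate μ x s k i) := by
  have hshift : ∀ i, ∑ k ∈ arrivalConf Kbar i s,
      g (k - econf i) * (vrate Kbar a μ ρ x s k i - wrate μ x s k i)
      = ∑ k ∈ (Kc Kbar s).filter (fun k => k + econf i ∈ Kbar s),
        g k * (vrate Kbar a μ ρ x s (k + econf i) i - wrate μ x s (k + econf i) i) := by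
    intro i
    rw [sum_arrivalConf_eq hzero i s
      (fun j k => g j * (vrate Kbar a μ ρ x s k i - wrate μ x s k i))]
    simp [hg]
  obtain ⟨d, hd⟩ : ∃ d : (I → ℕ) → I → ℝ,
      ∀ k i, vrate Kbar a μ ρ x s k i - wrate μ x s k i = d k i := ⟨_, fun _ _ => rfl⟩
  simp only [Fdrift, hd] at hshift ⊢
  simp only [sub_mul, Finset.sum_sub_distrib, hshift]
  simp only [mul_sub, Finset.sum_sub_distrib, arrivalConf, Finset.sum_filter, Finset.mul_sum,
    mul_ite, mul_zero]
  rw [Finset.sum_comm]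
  exact congrArg _ Finset.sum_comm

omit [DecidableEq I] [Fintype S] in
theorem xval_pos {Kbar : S → Finset (I → ℕ)} {a : S → ℝ} (hapos : ∀ s, 0 < a s)
    {x : S → (I → ℕ) → ℝ} (hpos : ∀ s, ∀ k ∈ Kc Kbar s, 0 < x s k) {s : S} {k : I → ℕ}
    (hk : k ∈ Kbar s) : 0 < xval a x s k := by
  unfold xval
  split_ifs with h
  · exact hapos s
  · exact hpos s k (Finset.mem_erase.2 ⟨h, hk⟩)

theorem sum_xval_sub_econf_eq_xavail {Kbar : S → Finset (I → ℕ)} (hzero : KbarZero Kbar)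
    (a : S → ℝ) (x : S → (I → ℕ) → ℝ) (i : I) :
    ∑ s, ∑ k ∈ arrivalConf Kbar i s, xval a x s (k - econf i) = xavail Kbar a x i := by
  refine Finset.sum_congr rfl fun s _ => ?_
  rw [sum_arrivalConf_eq hzero i s (fun j _ => xval a x s j)]
  refine congrArg₂ _ (by simp [xval]) (Finset.sum_congr rfl fun k hk => ?_)
  simp only [Kc, Finset.mem_filter, Finset.mem_erase] at hk
  simp [xval, hk.1.1]

omit [Fintype S] in
theorem sum_arrivalConf_mul_eq {Kbar : S → Finset (I → ℕ)} (hmono : KbarMono Kbar)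
    (x : S → (I → ℕ) → ℝ) (i : I) (s : S) :
    ∑ k ∈ arrivalConf Kbar i s, (k i : ℝ) * x s k = ∑ k ∈ Kc Kbar s, (k i : ℝ) * x s k := by
  refine Finset.sum_subset (Finset.filter_subset _ _) fun k hk hk' => ?_
  have h0 : k i = 0 := by
    by_contra h
    refine hk' (Finset.mem_filter.2 ⟨hk, by omega, ?_⟩)
    exact hmono s k (Finset.mem_of_mem_erase hk) _ fun j => Nat.sub_le _ _
  simp [h0]

theorem xavail_pos {Kbar : S → Finset (I → ℕ)} (hserve : KbarServe Kbar)
    {a : S → ℝ} (hapos : ∀ s, 0 < a s) {x : S → (I → ℕ) → ℝ}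
    (hpos : ∀ s, ∀ k ∈ Kc Kbar s, 0 < x s k) (i : I) : 0 < xavail Kbar a x i := by
  have hsum : ∀ s, 0 ≤ ∑ k ∈ (Kc Kbar s).filter (fun k => k + econf i ∈ Kbar s), x s k :=
    fun s => Finset.sum_nonneg fun k hk => (hpos s k (Finset.mem_filter.1 hk).1).le
  obtain ⟨s, hs⟩ := hserve i
  refine Finset.sum_pos' (fun t _ => add_nonneg ?_ (hsum t)) ⟨s, Finset.mem_univ s, ?_⟩
  · split_ifs
    exacts [(hapos t).le, le_rfl]
  · have hmem : econf i ∈ Kc Kbar s :=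
      Finset.mem_erase.2 ⟨fun h => by simpa [econf] using congrFun h i, hs⟩
    rw [if_pos hmem]
    exact add_pos_of_pos_of_nonneg (hapos s) (hsum s)

/-- the derivative of `L^{(a)}` along the GRAND(aZ) fluid vector field
equals `Ξ(x)`. -/
theorem Lfun_derivative_along_drift_eq_Xi
    (Kbar : S → Finset (I → ℕ))
    (hmono : KbarMono Kbar) (hzero : KbarZero Kbar) (hserve : KbarServe Kbar)
    (ρ : I → ℝ) (hρpos : ∀ i, 0 < ρ i) (hρsum : ∑ i, ρ i = 1)
    (a : S → ℝ) (hapos : ∀ s, 0 < a s)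
    (μ : I → ℝ) (hμpos : ∀ i, 0 < μ i)
    (x : S → (I → ℕ) → ℝ) (hx : x ∈ feasX Kbar ρ)
    (hpos : ∀ s, ∀ k ∈ Kc Kbar s, 0 < x s k) :
    ∑ s, ∑ k ∈ Kc Kbar s,
        Real.log (x s k * ck k / a s) * Fdrift Kbar a μ ρ x s k
      = Xi Kbar a μ x := by
  have hlog : ∀ i s, ∀ k ∈ arrivalConf Kbar i s,
      Real.log (xval a x s k * ck k / a s)
        - Real.log (xval a x s (k - econf i) * ck (k - econf i) / a s)
      = Real.log ((k i : ℝ) * x s k) - Real.log (xval a x s (k - econf i)) := by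
    intro i s k hk
    obtain ⟨hkK, hki, hkb⟩ := Finset.mem_filter.1 hk
    have hx0 := (hpos s k hkK).ne'
    have hb0 := (xval_pos hapos hpos hkb).ne'
    have hc0 := (ck_pos (k - econf i)).ne'
    have hk0 : (k i : ℝ) ≠ 0 := by
      exact_mod_cast (by omega : k i ≠ 0)
    have hxv : xval a x s k = x s k := if_neg (Finset.ne_of_mem_erase hkK)
    rw [hxv, ck_eq_mul_ck_sub_econf hki, Real.log_div (by positivity) (hapos s).ne',
      Real.log_div (by positivity) (hapos s).ne', Real.log_mul hx0 (by positivity),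
      Real.log_mul hk0 hc0, Real.log_mul hb0 hc0, Real.log_mul hk0 hx0]
    ring
  have hparts : ∀ s, ∑ k ∈ Kc Kbar s,
      Real.log (x s k * ck k / a s) * Fdrift Kbar a μ ρ x s k
      = ∑ i, ∑ k ∈ arrivalConf Kbar i s,
          (Real.log ((k i : ℝ) * x s k) - Real.log (xval a x s (k - econf i)))
            * (vrate Kbar a μ ρ x s k i - wrate μ x s k i) := by
    intro s
    have h := sum_mul_Fdrift_eq hzero a μ ρ x s
      (fun k => Real.log (xval a x s k * ck k / a s))
      (by simp [xval, ck, (hapos s).ne'])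
    calc _ = ∑ k ∈ Kc Kbar s,
          Real.log (xval a x s k * ck k / a s) * Fdrift Kbar a μ ρ x s k :=
          Finset.sum_congr rfl fun k hk => by
            rw [xval, if_neg (Finset.ne_of_mem_erase hk)]
      _ = _ := h
      _ = _ := Finset.sum_congr rfl fun i _ => Finset.sum_congr rfl fun k hk => by
          rw [hlog i s k hk]
  rw [Finset.sum_congr rfl fun s _ => hparts s, Finset.sum_comm]
  refine Finset.sum_congr rfl fun i _ => ?_
  have key := sum_mul_net_rate_eq (Finset.univ.sigma (arrivalConf Kbar i))
    (fun p => Real.log ((p.2 i : ℝ) * x p.1 p.2) - Real.log (xval a x p.1 (p.2 - econf i)))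
    (fun p => (p.2 i : ℝ) * x p.1 p.2) (fun p => xval a x p.1 (p.2 - econf i))
    (μ i) (xavail Kbar a x i) (ρ i)
    (by rw [Finset.sum_sigma]; exact sum_xval_sub_econf_eq_xavail hzero a x i)
    (xavail_pos hserve hapos hpos i).ne'
    (by
      rw [Finset.sum_sigma, ← hx.2 i]
      exact Finset.sum_congr rfl fun s _ => sum_arrivalConf_mul_eq hmono x i s)
  simp only [Finset.sum_sigma] at key
  refine Eq.trans ?_ (key.trans ?_)
  · refine Finset.sum_congr rfl fun s _ => Finset.sum_congr rfl fun k _ => ?_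
    rw [vrate, wrate]
    ring
  · refine Finset.sum_congr rfl fun s _ => Finset.sum_congr rfl fun k hk =>
      Finset.sum_congr rfl fun s' _ => Finset.sum_congr rfl fun k' hk' => ?_
    obtain ⟨hkK, hki, hkb⟩ := Finset.mem_filter.1 hk
    obtain ⟨hkK', hki', hkb'⟩ := Finset.mem_filter.1 hk'
    have hx0 := (hpos s k hkK).ne'
    have hx0' := (hpos s' k' hkK').ne'
    have hb0 := (xval_pos hapos hpos hkb).ne'
    have hb0' := (xval_pos hapos hpos hkb').ne'
    have hk0 : (k i : ℝ) ≠ 0 := by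
      exact_mod_cast (by omega : k i ≠ 0)
    have hk0' : (k' i : ℝ) ≠ 0 := by
      exact_mod_cast (by omega : k' i ≠ 0)
    rw [mul_right_comm (k' i : ℝ), Real.log_mul (mul_ne_zero hk0' hx0') hb0,
      Real.log_mul (mul_ne_zero hk0 hx0) hb0']
    ring
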